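/- Let Ū : (−1,1) → ℝ be continuous with constants u₊ > −2, α ∈ (0,1], C₀ > 0 such that |Ū(x) − 2 − 4/ln((1+x)/3)| ≤ C₀(ln((1+x)/3))^{−2} on (−1,0] and |Ū(x) − u₊| ≤ C₀(1−x)^α on [0,1). Let ε ∈ (0,1/2) satisfy 4ε > max{−u₊, 0}, and let ξ : (−1,1) → ℝ be continuous with |ξ(x)| ≤ N(ln((1+x)/3))^{−2}(1+x)(1−x)^{1−2ε} ≤ N(ln((1+x)/3))^{−2}(1−x)^{1−2ε} for all x. Then W(x) := e^{−a(x)} ∫₀ˣ e^{a(s)} ξ(s)/(1−s²) ds is well-defined and C¹ on (−1,1), satisfies (1−x²)W'(x) + (2x + Ū(x))W(x) = ξ(x), and there exists C > 0 depending only on ε, u₊, α, C₀ such that for all x ∈ (−1,1): |ln((1+x)/3)·(1−x)^{−1+2ε}W(x)| ≤ C·N and |(1+x)(ln((1+x)/3))²(1−x)^{2ε}W'(x)| ≤ C·N; in particular W(x) → 0 as x → ±1. -/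

import Mathlib

open Set Filter

/-- `a(x) = ∫₀ˣ (2s + Ū(s))/(1−s²) ds`. -/
noncomputable def aF (U : ℝ → ℝ) (x : ℝ) : ℝ := ∫ s in (0:ℝ)..x, (2*s + U s) / (1 - s^2)

theorem hasDerivAt_integral_of_continuousOn_Ioo {f : ℝ → ℝ} {a b c x : ℝ}
    (hf : ContinuousOn f (Ioo a b)) (hc : c ∈ Ioo a b) (hx : x ∈ Ioo a b) :
    HasDerivAt (fun y => ∫ s in c..y, f s) (f x) x := by
  have hsub : uIcc c x ⊆ Ioo a b := (ordConnected_Ioo).uIcc_subset hc hx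
  exact intervalIntegral.integral_hasDerivAt_right
    (hf.mono hsub).intervalIntegrable
    (hf.stronglyMeasurableAtFilter isOpen_Ioo x hx)
    (hf.continuousAt (isOpen_Ioo.mem_nhds hx))

/-- A supersolution `φ` of `y' + A' y = f` bounds the solution `e^{-A} F` to the right of `0`. -/
theorem abs_exp_neg_mul_le_of_supersolution_right {A F φ A' f φ' : ℝ → ℝ} {b : ℝ}
    (hA : ∀ x ∈ Ico 0 b, HasDerivAt A (A' x) x)
    (hF : ∀ x ∈ Ico 0 b, HasDerivAt F (Real.exp (A x) * f x) x)
    (hφ : ∀ x ∈ Ico 0 b, HasDerivAt φ (φ' x) x)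
    (hle : ∀ x ∈ Ico 0 b, |f x| ≤ φ' x + A' x * φ x)
    (hF0 : F 0 = 0) (hφ0 : 0 ≤ φ 0) {x : ℝ} (hx : x ∈ Ico 0 b) :
    |Real.exp (-A x) * F x| ≤ φ x := by
  have key : ∀ σ : ℝ, |σ| = 1 → σ * F x ≤ Real.exp (A x) * φ x := by
    intro σ hσ
    have hd : ∀ y ∈ Ico 0 b, HasDerivAt (fun y => Real.exp (A y) * φ y - σ * F y)
        (Real.exp (A y) * A' y * φ y + Real.exp (A y) * φ' y - σ * (Real.exp (A y) * f y)) y :=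
      fun y hy => (((hA y hy).exp).mul (hφ y hy)).sub ((hF y hy).const_mul σ)
    have hmono : MonotoneOn (fun y => Real.exp (A y) * φ y - σ * F y) (Ico 0 b) := by
      refine monotoneOn_of_deriv_nonneg (convex_Ico _ _)
        (fun y hy => (hd y hy).continuousAt.continuousWithinAt)
        (fun y hy => (hd y (interior_subset hy)).differentiableAt.differentiableWithinAt) ?_
      intro y hy
      have hy := interior_subset hy
      rw [(hd y hy).deriv]
      have h1 : σ * f y ≤ φ' y + A' y * φ y := by
        refine (le_abs_self _).trans ?_
        rw [abs_mul, hσ, one_mul]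
        exact hle y hy
      have := mul_le_mul_of_nonneg_left h1 (Real.exp_pos (A y)).le
      linarith
    have h0 := hmono ⟨le_rfl, hx.1.trans_lt hx.2⟩ hx hx.1
    simp only [hF0] at h0
    have := mul_nonneg (Real.exp_pos (A 0)).le hφ0
    linarith
  have h1 := key 1 (by simp)
  have h2 := key (-1) (by simp)
  rw [Real.exp_neg, abs_mul, abs_of_pos (inv_pos.2 (Real.exp_pos _)),
    inv_mul_le_iff₀ (Real.exp_pos _), abs_le]
  constructor <;> linarith

/-- A supersolution for decreasing `x` bounds the solution `e^{-A} F` of `y' + A' y = f` to the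
left of `0`. -/
theorem abs_exp_neg_mul_le_of_supersolution_left {A F φ A' f φ' : ℝ → ℝ} {b : ℝ}
    (hA : ∀ x ∈ Ioc b 0, HasDerivAt A (A' x) x)
    (hF : ∀ x ∈ Ioc b 0, HasDerivAt F (Real.exp (A x) * f x) x)
    (hφ : ∀ x ∈ Ioc b 0, HasDerivAt φ (φ' x) x)
    (hle : ∀ x ∈ Ioc b 0, |f x| ≤ -(φ' x + A' x * φ x))
    (hF0 : F 0 = 0) (hφ0 : 0 ≤ φ 0) {x : ℝ} (hx : x ∈ Ioc b 0) :
    |Real.exp (-A x) * F x| ≤ φ x := by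
  have hmem : ∀ y ∈ Ico 0 (-b), -y ∈ Ioc b 0 := fun y hy =>
    ⟨by linarith [hy.2], by linarith [hy.1]⟩
  have h := abs_exp_neg_mul_le_of_supersolution_right (b := -b) (x := -x)
    (A := fun y => A (-y)) (F := fun y => F (-y)) (φ := fun y => φ (-y))
    (A' := fun y => -A' (-y)) (f := fun y => -f (-y)) (φ' := fun y => -φ' (-y))
    (fun y hy => by simpa [Function.comp_def] using (hA _ (hmem y hy)).scomp y (hasDerivAt_neg y))
    (fun y hy => by simpa [Function.comp_def] using (hF _ (hmem y hy)).scomp y (hasDerivAt_neg y))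
    (fun y hy => by simpa [Function.comp_def] using (hφ _ (hmem y hy)).scomp y (hasDerivAt_neg y))
    (fun y hy => by
      have := hle _ (hmem y hy)
      rw [abs_neg]
      linarith)
    (by simpa using hF0) (by simpa using hφ0) ⟨by linarith [hx.2], by linarith [hx.1]⟩
  simpa using h

theorem one_le_neg_log_div_three {x : ℝ} (hx : x ∈ Ioc (-1 : ℝ) 0) :
    1 ≤ -Real.log ((1 + x) / 3) := by
  have h1 : Real.log ((1 + x) / 3) ≤ Real.log (Real.exp (-1)) := by
    refine Real.log_le_log (by linarith [hx.1]) ?_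
    rw [Real.exp_neg, ← one_div, le_div_iff₀ (Real.exp_pos _)]
    have := Real.exp_one_lt_d9
    have := Real.exp_pos 1
    nlinarith [hx.1, hx.2]
  rw [Real.log_exp] at h1
  linarith

theorem neg_log_div_three_bounds {x : ℝ} (hx : x ∈ Ico (0 : ℝ) 1) :
    1 / 3 ≤ -Real.log ((1 + x) / 3) ∧ -Real.log ((1 + x) / 3) ≤ 2 := by
  have hpos : 0 < (1 + x) / 3 := by linarith [hx.1]
  constructor
  · have := Real.log_le_sub_one_of_pos hpos
    linarith [hx.2]
  · have := Real.one_sub_inv_le_log_of_pos hpos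
    have h3 : ((1 + x) / 3)⁻¹ ≤ 3 := by
      rw [inv_le_comm₀ hpos (by norm_num)]
      linarith [hx.1]
    linarith

theorem neg_log_div_three_pos {x : ℝ} (hx : x ∈ Ioo (-1 : ℝ) 1) :
    0 < -Real.log ((1 + x) / 3) := by
  have := Real.log_neg (x := (1 + x) / 3) (by linarith [hx.1]) (by linarith [hx.2])
  linarith

theorem one_add_eq_three_mul_exp_log {x : ℝ} (hx : -1 < x) :
    1 + x = 3 * Real.exp (Real.log ((1 + x) / 3)) := by
  rw [Real.exp_log (by linarith)]
  ring

theorem one_add_mul_neg_log_le {x : ℝ} (hx : x ∈ Ioo (-1 : ℝ) 1) :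
    (1 + x) * -Real.log ((1 + x) / 3) ≤ 3 := by
  have h := one_add_eq_three_mul_exp_log hx.1
  set L := Real.log ((1 + x) / 3)
  rw [h]
  have h2 := Real.add_one_le_exp (-L)
  rw [Real.exp_neg] at h2
  have h3 := Real.exp_pos L
  have h4 := mul_le_mul_of_nonneg_left h2 h3.le
  rw [mul_inv_cancel₀ h3.ne'] at h4
  nlinarith

theorem one_add_mul_log_sq_le {x : ℝ} (hx : x ∈ Ioo (-1 : ℝ) 1) :
    (1 + x) * Real.log ((1 + x) / 3) ^ 2 ≤ 6 := by
  have h := one_add_eq_three_mul_exp_log hx.1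
  have hpos := neg_log_div_three_pos hx
  set L := Real.log ((1 + x) / 3)
  rw [h]
  have h2 := Real.quadratic_le_exp_of_nonneg hpos.le
  rw [Real.exp_neg] at h2
  have h3 := Real.exp_pos L
  have h4 := mul_le_mul_of_nonneg_left h2 h3.le
  rw [mul_inv_cancel₀ h3.ne'] at h4
  nlinarith [mul_pos h3 hpos]

/-- The coefficient `2x + Ū` is dominated by `1 / |ln((1+x)/3)|`. -/
theorem neg_log_mul_abs_coeff_le {U : ℝ → ℝ} {up α C₀ : ℝ} (hα : 0 < α) (hC₀ : 0 < C₀)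
    (hU1 : ∀ x ∈ Ioc (-1:ℝ) 0,
      |U x - 2 - 4 / Real.log ((1+x)/3)| ≤ C₀ / (Real.log ((1+x)/3))^2)
    (hU2 : ∀ x ∈ Ico (0:ℝ) 1, |U x - up| ≤ C₀ * (1-x) ^ α) {x : ℝ} (hx : x ∈ Ioo (-1 : ℝ) 1) :
    -Real.log ((1 + x) / 3) * |2 * x + U x| ≤ 10 + 2 * |up| + 2 * C₀ := by
  have hpos := neg_log_div_three_pos hx
  rcases le_or_gt x 0 with h0 | h0
  · have hb := one_add_mul_neg_log_le hx
    have h1 := one_le_neg_log_div_three ⟨hx.1, h0⟩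
    have hu := hU1 x ⟨hx.1, h0⟩
    set L := Real.log ((1 + x) / 3)
    have hL : L ≠ 0 := by linarith
    have e1 : -L * |U x - 2 - 4 / L| ≤ C₀ := by
      calc -L * |U x - 2 - 4 / L| ≤ -L * (C₀ / L ^ 2) := mul_le_mul_of_nonneg_left hu hpos.le
        _ = C₀ / -L := by field_simp
        _ ≤ C₀ := div_le_self hC₀.le h1
    have e2 : -L * |2 * x + U x| = |-L * (U x - 2 - 4 / L) + 2 * ((1 + x) * -L) - 4| := by
      rw [← abs_of_pos hpos, ← abs_mul, abs_of_pos hpos]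
      congr 1
      field_simp
      ring
    have e3 : |-L * (U x - 2 - 4 / L)| ≤ C₀ := by rwa [abs_mul, abs_of_pos hpos]
    have h5 : 0 < (1 + x) * -L := mul_pos (by linarith [hx.1]) hpos
    rw [e2, abs_le]
    rw [abs_le] at e3
    have := abs_nonneg up
    constructor <;> linarith
  · have hb := (neg_log_div_three_bounds ⟨h0.le, hx.2⟩).2
    have hu := hU2 x ⟨h0.le, hx.2⟩
    have h1 : (1 - x) ^ α ≤ 1 :=
      Real.rpow_le_one (by linarith [hx.2]) (by linarith) hα.le
    have h2 : |2 * x + U x| ≤ 2 + |up| + C₀ := by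
      have h3 : |U x - up| ≤ C₀ := hu.trans (by nlinarith)
      rw [abs_le] at h3 ⊢
      have := le_abs_self up
      have := neg_abs_le up
      constructor <;> linarith [hx.2]
    have := mul_le_mul hb h2 (abs_nonneg _) (by norm_num)
    linarith

/-- Near `-1`, `e^{-M/ℓ}/ℓ` with `ℓ = -ln((1+x)/3)` is a supersolution for decreasing `x`. -/
theorem abs_le_neg_log_supersolution {U ξ : ℝ → ℝ} {C₀ p N x : ℝ} (hC₀ : 0 < C₀)
    (hp : 0 < p) (hp1 : p < 1) (hN : 0 ≤ N) (hx : x ∈ Ioc (-1 : ℝ) 0)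
    (hU : |U x - 2 - 4 / Real.log ((1+x)/3)| ≤ C₀ / (Real.log ((1+x)/3))^2)
    (hξ : |ξ x| ≤ N * (1-x) ^ p / (Real.log ((1+x)/3))^2) :
    |ξ x / (1 - x ^ 2)| ≤
      -(Real.exp (C₀ + 12) * N * (Real.exp ((C₀ + 12) * (Real.log ((1+x)/3))⁻¹)
          * (-(C₀ + 12) * ((1 + x)⁻¹ / (Real.log ((1+x)/3))^2)
              * -(Real.log ((1+x)/3))⁻¹
            + (1 + x)⁻¹ / (Real.log ((1+x)/3))^2))
        + (2 * x + U x) / (1 - x ^ 2) * (Real.exp (C₀ + 12) * N *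
          (Real.exp ((C₀ + 12) * (Real.log ((1+x)/3))⁻¹) * -(Real.log ((1+x)/3))⁻¹))) := by
  have h1x : 0 < 1 + x := by linarith [hx.1]
  have h1x' : 1 ≤ 1 - x := by linarith [hx.2]
  have hsq : 0 < 1 - x ^ 2 := by nlinarith
  have h1 := one_le_neg_log_div_three hx
  have h6 := one_add_mul_log_sq_le (x := x) ⟨hx.1, by linarith [hx.2]⟩
  set L := Real.log ((1 + x) / 3)
  have hl : L = -(-L) := by ring
  set l := -L
  rw [hl] at hU hξ h6 ⊢
  have hl0 : 0 < l := by linarith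
  set M := C₀ + 12 with hM
  set E := Real.exp (M * (-l)⁻¹) with hE
  have hEpos : 0 < E := Real.exp_pos _
  have hE1 : 1 ≤ Real.exp M * E := by
    rw [hE, ← Real.exp_add, ← Real.exp_zero]
    apply Real.exp_le_exp.2
    have : l⁻¹ ≤ 1 := inv_le_one_of_one_le₀ h1
    rw [inv_neg]
    nlinarith
  have hpow : (1 - x) ^ p ≤ 2 := by
    calc (1 - x) ^ p ≤ (1 - x) ^ (1 : ℝ) := Real.rpow_le_rpow_of_exponent_le h1x' hp1.le
      _ = 1 - x := Real.rpow_one _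
      _ ≤ 2 := by linarith
  have hrhs : -(Real.exp M * N * (E * (-M * ((1 + x)⁻¹ / (-l)^2) * -(-l)⁻¹
            + (1 + x)⁻¹ / (-l)^2)) + (2 * x + U x) / (1 - x ^ 2) * (Real.exp M * N *
          (E * -(-l)⁻¹)))
      = (Real.exp M * E * N * ((M * (1 - x) / l - (1 - x) - (2 * x + U x) * l) / l ^ 2))
          / (1 - x ^ 2) := by
    have : 1 - x ^ 2 = (1 + x) * (1 - x) := by ring
    have h3 : 1 - x ≠ 0 := by linarith
    rw [this]
    field_simp
    ring
  rw [hrhs, abs_div, abs_of_pos hsq]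
  refine div_le_div_of_nonneg_right ?_ hsq.le
  have hc : 2 ≤ M * (1 - x) / l - (1 - x) - (2 * x + U x) * l := by
    have hu := (abs_le.1 hU).2
    have hu2 : U x * l ≤ 2 * l - 4 + C₀ / l := by
      have : U x ≤ 2 + 4 / (-l) + C₀ / (-l) ^ 2 := by linarith
      calc U x * l ≤ (2 + 4 / (-l) + C₀ / (-l) ^ 2) * l :=
            mul_le_mul_of_nonneg_right this hl0.le
        _ = _ := by field_simp; ring
    have hu3 : 2 * (1 + x) * l ≤ 12 / l := by
      rw [le_div_iff₀ hl0]
      nlinarith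
    have hu4 : M / l ≤ M * (1 - x) / l := by
      refine div_le_div_of_nonneg_right ?_ hl0.le
      nlinarith
    have hu5 : M / l = C₀ / l + 12 / l := by rw [hM, add_div]
    nlinarith
  have hl2 : 0 < l ^ 2 := by positivity
  calc |ξ x| ≤ N * (1 - x) ^ p / (-l) ^ 2 := hξ
    _ ≤ N * 2 / l ^ 2 := by rw [neg_sq]; gcongr
    _ ≤ N * (M * (1 - x) / l - (1 - x) - (2 * x + U x) * l) / l ^ 2 := by gcongr
    _ = 1 * N * ((M * (1 - x) / l - (1 - x) - (2 * x + U x) * l) / l ^ 2) := by ring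
    _ ≤ _ := by
      have : 0 ≤ (M * (1 - x) / l - (1 - x) - (2 * x + U x) * l) / l ^ 2 := by
        apply div_nonneg _ hl2.le
        linarith
      gcongr

/-- Near `1`, `(1-x)^p e^{-(M/α)(1-x)^α}` is a supersolution. -/
theorem abs_le_rpow_supersolution {U ξ : ℝ → ℝ} {up α C₀ ε N x : ℝ}
    (hα : 0 < α) (hα1 : α ≤ 1) (hC₀ : 0 < C₀) (hε2 : ε < 1 / 2)
    (h4ε : -up < 4 * ε) (hN : 0 ≤ N) (hx : x ∈ Ico (0 : ℝ) 1)
    (hU : |U x - up| ≤ C₀ * (1-x) ^ α)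
    (hξ : |ξ x| ≤ N * (1-x) ^ (1 - 2 * ε) / (Real.log ((1+x)/3))^2) :
    |ξ x / (1 - x ^ 2)| ≤
      9 / (up + 4 * ε) * Real.exp ((C₀ + 2) / α) * N *
        (-((1 - 2 * ε) * (1 - x) ^ (1 - 2 * ε - 1))
            * Real.exp (-((C₀ + 2) / α * (1 - x) ^ α))
          + (1 - x) ^ (1 - 2 * ε) * (Real.exp (-((C₀ + 2) / α * (1 - x) ^ α)) *
            ((C₀ + 2) / α * (α * (1 - x) ^ (α - 1)))))
      + (2 * x + U x) / (1 - x ^ 2) * (9 / (up + 4 * ε) * Real.exp ((C₀ + 2) / α) * N *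
          ((1 - x) ^ (1 - 2 * ε) * Real.exp (-((C₀ + 2) / α * (1 - x) ^ α)))) := by
  have h1x : 0 < 1 - x := by linarith [hx.2]
  have hsq : 0 < 1 - x ^ 2 := by nlinarith [hx.1]
  have hlog := (neg_log_div_three_bounds hx).1
  have hδ : 0 < up + 4 * ε := by linarith
  set δ := up + 4 * ε with hδdef
  rw [Real.rpow_sub_one h1x.ne', Real.rpow_sub_one h1x.ne']
  have ht1 : (1 - x) ^ α ≤ 1 := Real.rpow_le_one h1x.le (by linarith [hx.1]) hα.le
  have htx : 1 - x ≤ (1 - x) ^ α := by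
    simpa using Real.rpow_le_rpow_of_exponent_ge h1x (by linarith [hx.1]) hα1
  have hP : 0 < (1 - x) ^ (1 - 2 * ε) := Real.rpow_pos_of_pos h1x _
  set t := (1 - x) ^ α
  set P := (1 - x) ^ (1 - 2 * ε)
  set M := C₀ + 2 with hM
  set E := Real.exp (-(M / α * t)) with hE
  have hE1 : 1 ≤ Real.exp (M / α) * E := by
    rw [hE, ← Real.exp_add, ← Real.exp_zero]
    apply Real.exp_le_exp.2
    have : 0 ≤ M / α := by positivity
    nlinarith
  have hrhs : 9 / δ * Real.exp (M / α) * N * (-((1 - 2 * ε) * (P / (1 - x))) * E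
        + P * (E * (M / α * (α * (t / (1 - x))))))
        + (2 * x + U x) / (1 - x ^ 2) * (9 / δ * Real.exp (M / α) * N * (P * E))
      = (Real.exp (M / α) * E * (9 / δ * N * P *
          (M * t * (1 + x) - (1 - 2 * ε) * (1 + x) + (2 * x + U x)))) / (1 - x ^ 2) := by
    have : 1 - x ^ 2 = (1 + x) * (1 - x) := by ring
    have h3 : 1 + x ≠ 0 := by linarith [hx.1]
    rw [this]
    field_simp
    ring
  rw [hrhs, abs_div, abs_of_pos hsq]
  refine div_le_div_of_nonneg_right ?_ hsq.le
  have hc : δ ≤ M * t * (1 + x) - (1 - 2 * ε) * (1 + x) + (2 * x + U x) := by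
    have hu := (abs_le.1 hU).1
    have h1 : M * t ≤ M * t * (1 + x) := by
      have : 0 ≤ M * t := by nlinarith
      nlinarith [hx.1]
    have h2 : (1 + 2 * ε) * (1 - x) ≤ 2 * t := by nlinarith
    nlinarith
  have hl2 : 1 / 9 ≤ Real.log ((1 + x) / 3) ^ 2 := by nlinarith
  calc |ξ x| ≤ N * P / Real.log ((1 + x) / 3) ^ 2 := hξ
    _ ≤ N * P / (1 / 9) := by gcongr
    _ = 1 * (9 / δ * N * P * δ) := by field_simp
    _ ≤ _ := by gcongr

theorem hasDerivAt_log_div_three {x : ℝ} (hx : -1 < x) :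
    HasDerivAt (fun x : ℝ => Real.log ((1 + x) / 3)) (1 + x)⁻¹ x := by
  have h : HasDerivAt (fun x : ℝ => (1 + x) / 3) (1 / 3) x :=
    ((hasDerivAt_id x).const_add 1).div_const 3
  convert h.log (by linarith) using 1
  have : 1 + x ≠ 0 := by linarith
  field_simp

theorem hasDerivAt_one_sub_rpow {x : ℝ} (q : ℝ) (hx : x < 1) :
    HasDerivAt (fun x : ℝ => (1 - x) ^ q) (-(q * (1 - x) ^ (q - 1))) x := by
  have h : HasDerivAt (fun x : ℝ => 1 - x) (-1) x := (hasDerivAt_id x).const_sub 1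
  convert h.rpow_const (p := q) (Or.inl (by linarith)) using 1
  ring

/-- Uniform bound on `|ln((1+x)/3)| (1-x)^{-1+2ε} |W(x)|`. -/
theorem exists_weighted_bound (up α C₀ ε : ℝ)
    (hα : 0 < α) (hα1 : α ≤ 1) (hC₀ : 0 < C₀)
    (hε1 : 0 < ε) (hε2 : ε < 1/2) (h4ε : -up < 4*ε) :
    ∃ K > 0, ∀ (U ξ A F : ℝ → ℝ) (N : ℝ), 0 ≤ N →
      (∀ x ∈ Ioc (-1:ℝ) 0,
        |U x - 2 - 4 / Real.log ((1+x)/3)| ≤ C₀ / (Real.log ((1+x)/3))^2) →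
      (∀ x ∈ Ico (0:ℝ) 1, |U x - up| ≤ C₀ * (1-x) ^ α) →
      (∀ x ∈ Ioo (-1:ℝ) 1, |ξ x| ≤ N * (1-x) ^ (1-2*ε) / (Real.log ((1+x)/3))^2) →
      (∀ x ∈ Ioo (-1:ℝ) 1, HasDerivAt A ((2 * x + U x) / (1 - x ^ 2)) x) →
      (∀ x ∈ Ioo (-1:ℝ) 1, HasDerivAt F (Real.exp (A x) * (ξ x / (1 - x ^ 2))) x) →
      F 0 = 0 →
      ∀ x ∈ Ioo (-1:ℝ) 1,
        |Real.log ((1+x)/3)| * (1-x) ^ (-1+2*ε) * |Real.exp (-A x) * F x| ≤ K * N := by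
  have hδ : 0 < up + 4 * ε := by linarith
  refine ⟨Real.exp (C₀ + 12) + 2 * (9 / (up + 4 * ε) * Real.exp ((C₀ + 2) / α)),
    by positivity, ?_⟩
  intro U ξ A F N hN hU1 hU2 hξ hA hF hF0 x hx
  have hpos := neg_log_div_three_pos hx
  rw [abs_of_neg (by linarith)]
  have hK2 : 0 ≤ 9 / (up + 4 * ε) * Real.exp ((C₀ + 2) / α) * N := by positivity
  have hK1 : 0 ≤ Real.exp (C₀ + 12) * N := by positivity
  have h1x : 0 < 1 - x := by linarith [hx.2]
  rcases le_or_gt x 0 with h0 | h0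
  · have hsub : ∀ y ∈ Ioc (-1:ℝ) 0, y ∈ Ioo (-1:ℝ) 1 := fun y hy =>
      ⟨hy.1, by linarith [hy.2]⟩
    have hφ : ∀ y ∈ Ioc (-1:ℝ) 0, HasDerivAt
        (fun y => Real.exp (C₀ + 12) * N * (Real.exp ((C₀ + 12) * (Real.log ((1+y)/3))⁻¹)
          * -(Real.log ((1+y)/3))⁻¹))
        (Real.exp (C₀ + 12) * N * (Real.exp ((C₀ + 12) * (Real.log ((1+y)/3))⁻¹)
          * (-(C₀ + 12) * ((1 + y)⁻¹ / (Real.log ((1+y)/3))^2)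
              * -(Real.log ((1+y)/3))⁻¹
            + (1 + y)⁻¹ / (Real.log ((1+y)/3))^2))) y := by
      intro y hy
      have h1 := (hasDerivAt_log_div_three hy.1).fun_inv
        (by linarith [one_le_neg_log_div_three hy])
      refine (((h1.const_mul (C₀ + 12)).exp.fun_mul h1.fun_neg).const_mul
        (Real.exp (C₀ + 12) * N)).congr_deriv ?_
      ring
    have h := abs_exp_neg_mul_le_of_supersolution_left (fun y hy => hA y (hsub y hy))
      (fun y hy => hF y (hsub y hy)) hφ
      (fun y hy => abs_le_neg_log_supersolution hC₀ (by linarith) (by linarith) hN hy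
        (hU1 y hy) (hξ y (hsub y hy)))
      hF0
      (mul_nonneg hK1 (mul_nonneg (Real.exp_pos _).le (neg_nonneg.2 (inv_nonpos.2
        (by linarith [neg_log_div_three_pos (x := 0) (by norm_num)])))))
      ⟨hx.1, h0⟩
    set L := Real.log ((1 + x) / 3)
    have hpow : (1 - x) ^ (-1 + 2 * ε) ≤ 1 :=
      Real.rpow_le_one_of_one_le_of_nonpos (by linarith) (by linarith)
    have hexp : Real.exp ((C₀ + 12) * L⁻¹) ≤ 1 := by
      rw [Real.exp_le_one_iff]
      have : L⁻¹ ≤ 0 := inv_nonpos.2 (by linarith)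
      nlinarith
    have hLinv : 0 ≤ -L⁻¹ := neg_nonneg.2 (inv_nonpos.2 (by linarith))
    calc -L * (1 - x) ^ (-1 + 2 * ε) * |Real.exp (-A x) * F x|
        ≤ -L * 1 * (Real.exp (C₀ + 12) * N * (1 * -L⁻¹)) := by
          refine mul_le_mul (mul_le_mul_of_nonneg_left hpow hpos.le) (h.trans ?_)
            (abs_nonneg _) (by linarith)
          exact mul_le_mul_of_nonneg_left (mul_le_mul_of_nonneg_right hexp hLinv) hK1
      _ = Real.exp (C₀ + 12) * N := by
          have : L ≠ 0 := by linarith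
          field_simp
      _ ≤ _ := by linarith
  · have hsub : ∀ y ∈ Ico (0:ℝ) 1, y ∈ Ioo (-1:ℝ) 1 := fun y hy =>
      ⟨by linarith [hy.1], hy.2⟩
    have hφ : ∀ y ∈ Ico (0:ℝ) 1, HasDerivAt
        (fun y => 9 / (up + 4 * ε) * Real.exp ((C₀ + 2) / α) * N *
          ((1 - y) ^ (1 - 2 * ε) * Real.exp (-((C₀ + 2) / α * (1 - y) ^ α))))
        (9 / (up + 4 * ε) * Real.exp ((C₀ + 2) / α) * N *
        (-((1 - 2 * ε) * (1 - y) ^ (1 - 2 * ε - 1))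
            * Real.exp (-((C₀ + 2) / α * (1 - y) ^ α))
          + (1 - y) ^ (1 - 2 * ε) * (Real.exp (-((C₀ + 2) / α * (1 - y) ^ α)) *
            ((C₀ + 2) / α * (α * (1 - y) ^ (α - 1)))))) y := by
      intro y hy
      refine (((hasDerivAt_one_sub_rpow (1 - 2 * ε) hy.2).fun_mul
        ((hasDerivAt_one_sub_rpow α hy.2).const_mul ((C₀ + 2) / α)).fun_neg.exp).const_mul
        (9 / (up + 4 * ε) * Real.exp ((C₀ + 2) / α) * N)).congr_deriv ?_
      ring
    have h := abs_exp_neg_mul_le_of_supersolution_right (fun y hy => hA y (hsub y hy))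
      (fun y hy => hF y (hsub y hy)) hφ
      (fun y hy => abs_le_rpow_supersolution hα hα1 hC₀ hε2 h4ε hN hy
        (hU2 y hy) (hξ y (hsub y hy)))
      hF0
      (mul_nonneg hK2 (mul_nonneg (by norm_num) (Real.exp_pos _).le))
      ⟨h0.le, hx.2⟩
    have hlog := (neg_log_div_three_bounds ⟨h0.le, hx.2⟩).2
    have hP : 0 < (1 - x) ^ (1 - 2 * ε) := Real.rpow_pos_of_pos h1x _
    have hexp : Real.exp (-((C₀ + 2) / α * (1 - x) ^ α)) ≤ 1 := by
      rw [Real.exp_le_one_iff, neg_nonpos]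
      exact mul_nonneg (by positivity) (Real.rpow_nonneg h1x.le _)
    have hinv : (1 - x) ^ (-1 + 2 * ε) = ((1 - x) ^ (1 - 2 * ε))⁻¹ := by
      rw [← Real.rpow_neg h1x.le]
      ring_nf
    rw [hinv]
    calc -Real.log ((1 + x) / 3) * ((1 - x) ^ (1 - 2 * ε))⁻¹ * |Real.exp (-A x) * F x|
        ≤ 2 * ((1 - x) ^ (1 - 2 * ε))⁻¹ * (9 / (up + 4 * ε) * Real.exp ((C₀ + 2) / α) * N *
          ((1 - x) ^ (1 - 2 * ε) * 1)) := by
          refine mul_le_mul (mul_le_mul_of_nonneg_right hlog (by positivity)) (h.trans ?_)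
            (abs_nonneg _) (by positivity)
          exact mul_le_mul_of_nonneg_left (mul_le_mul_of_nonneg_left hexp hP.le) hK2
      _ = 2 * (9 / (up + 4 * ε) * Real.exp ((C₀ + 2) / α) * N) := by
          field_simp
      _ ≤ _ := by linarith

/-- logarithmic case at `−1` (`Ū → 2` with `η₁ = 4`), power case at `1`
with `u₊ > −2`: `W(x) = e^{−a(x)} ∫₀ˣ e^{a(s)} ξ(s)/(1−s²) ds` solves
`(1−x²)W' + (2x+Ū)W = ξ` with log-weighted `C·N` bounds and `W → 0` at `±1`. -/
theorem stmt14 (up α C₀ ε : ℝ) (hup : -2 < up)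
    (hα : 0 < α) (hα1 : α ≤ 1) (hC₀ : 0 < C₀)
    (hε1 : 0 < ε) (hε2 : ε < 1/2) (h4ε : -up < 4*ε) :
    ∃ C > 0, ∀ (U ξ : ℝ → ℝ) (N : ℝ),
      ContinuousOn U (Ioo (-1:ℝ) 1) →
      (∀ x ∈ Ioc (-1:ℝ) 0,
        |U x - 2 - 4 / Real.log ((1+x)/3)| ≤ C₀ / (Real.log ((1+x)/3))^2) →
      (∀ x ∈ Ico (0:ℝ) 1, |U x - up| ≤ C₀ * (1-x) ^ α) →
      ContinuousOn ξ (Ioo (-1:ℝ) 1) →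
      (∀ x ∈ Ioo (-1:ℝ) 1,
        |ξ x| ≤ N * (1+x) * (1-x) ^ (1-2*ε) / (Real.log ((1+x)/3))^2 ∧
        |ξ x| ≤ N * (1-x) ^ (1-2*ε) / (Real.log ((1+x)/3))^2) →
      (let W : ℝ → ℝ := fun x =>
        Real.exp (-(aF U x)) * ∫ s in (0:ℝ)..x, Real.exp (aF U s) * ξ s / (1-s^2)
       ∃ W' : ℝ → ℝ,
        ContinuousOn W' (Ioo (-1:ℝ) 1) ∧
        (∀ x ∈ Ioo (-1:ℝ) 1, HasDerivAt W (W' x) x) ∧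
        (∀ x ∈ Ioo (-1:ℝ) 1, (1-x^2) * W' x + (2*x + U x) * W x = ξ x) ∧
        (∀ x ∈ Ioo (-1:ℝ) 1,
          |Real.log ((1+x)/3)| * (1-x) ^ (-1+2*ε) * |W x| ≤ C * N ∧
          (1+x) * (Real.log ((1+x)/3))^2 * (1-x) ^ (2*ε) * |W' x| ≤ C * N) ∧
        Tendsto W (nhdsWithin (-1:ℝ) (Ioo (-1:ℝ) 1)) (nhds 0) ∧
        Tendsto W (nhdsWithin (1:ℝ) (Ioo (-1:ℝ) 1)) (nhds 0)) := by
  obtain ⟨K, hK, hbound⟩ := exists_weighted_bound up α C₀ ε hα hα1 hC₀ hε1 hε2 h4ε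
  set B := 10 + 2 * |up| + 2 * C₀ with hB
  have hBpos : 0 < B := by positivity
  refine ⟨K + (1 + B * K), by positivity, ?_⟩
  intro U ξ N hU hU1 hU2 hξ hξb W
  have hN : 0 ≤ N := by
    have h := (abs_nonneg _).trans (hξb 0 (by norm_num)).2
    have hl : 0 < Real.log ((1 + 0) / 3) ^ 2 := by
      have := neg_log_div_three_pos (x := 0) (by norm_num)
      nlinarith
    rw [sub_zero, Real.one_rpow, mul_one, le_div_iff₀ hl, zero_mul] at h
    exact h
  have hsq : ∀ x ∈ Ioo (-1:ℝ) 1, 0 < 1 - x ^ 2 := fun x hx => by nlinarith [hx.1, hx.2]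
  have hcA : ContinuousOn (fun s => (2 * s + U s) / (1 - s ^ 2)) (Ioo (-1:ℝ) 1) :=
    ContinuousOn.div (by fun_prop) (by fun_prop) fun x hx => (hsq x hx).ne'
  have hA : ∀ x ∈ Ioo (-1:ℝ) 1, HasDerivAt (aF U) ((2 * x + U x) / (1 - x ^ 2)) x :=
    fun x hx => hasDerivAt_integral_of_continuousOn_Ioo hcA (by norm_num) hx
  have hAc : ContinuousOn (aF U) (Ioo (-1:ℝ) 1) :=
    fun x hx => (hA x hx).continuousAt.continuousWithinAt
  have hcF : ContinuousOn (fun s => Real.exp (aF U s) * ξ s / (1 - s ^ 2)) (Ioo (-1:ℝ) 1) :=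
    ContinuousOn.div (by fun_prop) (by fun_prop) fun x hx => (hsq x hx).ne'
  have hF : ∀ x ∈ Ioo (-1:ℝ) 1,
      HasDerivAt (fun x => ∫ s in (0:ℝ)..x, Real.exp (aF U s) * ξ s / (1 - s ^ 2))
        (Real.exp (aF U x) * (ξ x / (1 - x ^ 2))) x := fun x hx => by
    rw [← mul_div_assoc]
    exact hasDerivAt_integral_of_continuousOn_Ioo hcF (by norm_num) hx
  have hW : ∀ x ∈ Ioo (-1:ℝ) 1,
      |Real.log ((1+x)/3)| * (1-x) ^ (-1+2*ε) * |W x| ≤ K * N :=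
    hbound U ξ (aF U) _ N hN hU1 hU2 (fun x hx => (hξb x hx).2) hA hF (by simp)
  have hWd : ∀ x ∈ Ioo (-1:ℝ) 1,
      HasDerivAt W ((ξ x - (2 * x + U x) * W x) / (1 - x ^ 2)) x := by
    intro x hx
    refine ((hA x hx).fun_neg.exp.fun_mul (hF x hx)).congr_deriv ?_
    have h1 : Real.exp (-aF U x) * Real.exp (aF U x) = 1 := by
      rw [← Real.exp_add, neg_add_cancel, Real.exp_zero]
    rw [← mul_assoc (Real.exp (-aF U x)) (Real.exp (aF U x)), h1]
    simp only [W]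
    ring
  have hWc : ContinuousOn W (Ioo (-1:ℝ) 1) :=
    fun x hx => (hWd x hx).continuousAt.continuousWithinAt
  have hWb : ∀ x ∈ Ioo (-1:ℝ) 1,
      |W x| ≤ K * N * (1 - x) ^ (1 - 2 * ε) * |(Real.log ((1+x)/3))⁻¹| := by
    intro x hx
    have h1x : 0 < 1 - x := by linarith [hx.2]
    have hP : 0 < (1 - x) ^ (1 - 2 * ε) := Real.rpow_pos_of_pos h1x _
    have hL : 0 < |Real.log ((1 + x) / 3)| :=
      abs_pos.2 (by linarith [neg_log_div_three_pos hx])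
    have h := hW x hx
    rw [show -1 + 2 * ε = -(1 - 2 * ε) by ring, Real.rpow_neg h1x.le] at h
    calc |W x| = |Real.log ((1 + x) / 3)| * ((1 - x) ^ (1 - 2 * ε))⁻¹ * |W x| *
          ((1 - x) ^ (1 - 2 * ε) * |Real.log ((1 + x) / 3)|⁻¹) := by field_simp
      _ ≤ K * N * ((1 - x) ^ (1 - 2 * ε) * |Real.log ((1 + x) / 3)|⁻¹) := by gcongr
      _ = _ := by rw [abs_inv, mul_assoc (K * N)]
  have hPc : Continuous fun x : ℝ => K * N * (1 - x) ^ (1 - 2 * ε) :=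
    continuous_const.mul ((continuous_const.sub continuous_id).rpow_const
      fun _ => Or.inr (by linarith))
  refine ⟨fun x => (ξ x - (2 * x + U x) * W x) / (1 - x ^ 2),
    ContinuousOn.div (by fun_prop) (by fun_prop) fun x hx => (hsq x hx).ne', hWd,
    fun x hx => ?_, fun x hx => ⟨(hW x hx).trans ?_, ?_⟩, ?_, ?_⟩
  · have := (hsq x hx).ne'
    field_simp
    ring
  · have : 0 ≤ (1 + B * K) * N := by positivity
    linarith
  · have h1x : 0 < 1 - x := by linarith [hx.2]
    have h1x' : 0 < 1 + x := by linarith [hx.1]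
    have hP : 0 < (1 - x) ^ (1 - 2 * ε) := Real.rpow_pos_of_pos h1x _
    have hpos := neg_log_div_three_pos hx
    have hcoef := neg_log_mul_abs_coeff_le hα hC₀ hU1 hU2 hx
    rw [← hB] at hcoef
    have hξx := (hξb x hx).2
    have hWx := hW x hx
    have hR : (1 - x) ^ (2 * ε) = (1 - x) ^ (-1 + 2 * ε) * (1 - x) := by
      rw [← Real.rpow_add_one h1x.ne']
      ring_nf
    have hQ : (1 - x) ^ (-1 + 2 * ε) = ((1 - x) ^ (1 - 2 * ε))⁻¹ := by
      rw [← Real.rpow_neg h1x.le]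
      ring_nf
    have hQ0 : 0 < (1 - x) ^ (-1 + 2 * ε) := Real.rpow_pos_of_pos h1x _
    rw [abs_of_neg (by linarith)] at hWx
    set L := Real.log ((1 + x) / 3)
    have hL : L ≠ 0 := by linarith
    have hL2 : 0 < L ^ 2 := by positivity
    have e1 : L ^ 2 * (1 - x) ^ (-1 + 2 * ε) * |ξ x| ≤ N := by
      calc L ^ 2 * (1 - x) ^ (-1 + 2 * ε) * |ξ x|
          ≤ L ^ 2 * (1 - x) ^ (-1 + 2 * ε) * (N * (1 - x) ^ (1 - 2 * ε) / L ^ 2) := by gcongr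
        _ = N := by rw [hQ]; field_simp
    have e2 := mul_le_mul hcoef hWx (by positivity) hBpos.le
    have e3 : |ξ x - (2 * x + U x) * W x| ≤ |ξ x| + |2 * x + U x| * |W x| := by
      rw [← abs_mul]
      exact abs_sub _ _
    rw [abs_div, abs_of_pos (hsq x hx), hR, show 1 - x ^ 2 = (1 + x) * (1 - x) by ring]
    calc (1 + x) * L ^ 2 * ((1 - x) ^ (-1 + 2 * ε) * (1 - x)) *
          (|ξ x - (2 * x + U x) * W x| / ((1 + x) * (1 - x)))
        = L ^ 2 * (1 - x) ^ (-1 + 2 * ε) * |ξ x - (2 * x + U x) * W x| := by field_simp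
      _ ≤ L ^ 2 * (1 - x) ^ (-1 + 2 * ε) * (|ξ x| + |2 * x + U x| * |W x|) := by gcongr
      _ = L ^ 2 * (1 - x) ^ (-1 + 2 * ε) * |ξ x| + -L * |2 * x + U x| *
          (-L * (1 - x) ^ (-1 + 2 * ε) * |W x|) := by ring
      _ ≤ N + B * (K * N) := add_le_add e1 e2
      _ ≤ _ := by nlinarith [mul_nonneg hK.le hN]
  · have hlim : Tendsto (fun x : ℝ => (1 + x) / 3) (nhdsWithin (-1:ℝ) (Ioo (-1:ℝ) 1))
        (nhdsWithin 0 (Ioi 0)) := by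
      refine tendsto_nhdsWithin_iff.2 ⟨?_, ?_⟩
      · refine Tendsto.mono_left ?_ nhdsWithin_le_nhds
        have : Continuous fun x : ℝ => (1 + x) / 3 := by fun_prop
        simpa using this.tendsto (-1)
      · filter_upwards [self_mem_nhdsWithin] with x hx
        exact mem_Ioi.2 (by linarith [hx.1])
    have h2 := (tendsto_inv_atBot_zero.comp (Real.tendsto_log_nhdsGT_zero.comp hlim)).abs
    have h3 := ((hPc.tendsto (-1)).mono_left
      (nhdsWithin_le_nhds (s := Ioo (-1:ℝ) 1))).mul h2
    rw [abs_zero, mul_zero] at h3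
    refine squeeze_zero_norm' ?_ h3
    filter_upwards [self_mem_nhdsWithin] with x hx using hWb x hx
  · have hlog : Real.log ((1 + 1) / 3) ≠ 0 :=
      (Real.log_neg (by norm_num) (by norm_num)).ne
    have h2 := ((hasDerivAt_log_div_three (x := 1) (by norm_num)).continuousAt.inv₀ hlog).abs
    have h3 := (((hPc.tendsto 1).mul h2.tendsto).mono_left
      (nhdsWithin_le_nhds (s := Ioo (-1:ℝ) 1)))
    rw [sub_self, Real.zero_rpow (by linarith), mul_zero, zero_mul] at h3
    refine squeeze_zero_norm' ?_ h3
    filter_upwards [self_mem_nhdsWithin] with x hx using hWb x hx
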